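/- Let x, y ∈ 𝔸₁. Then z ∈ 𝔸₁ is a minimal upper bound of x and y for the perturbation order if and only if x ≤ z, y ≤ z, and βᶻ is minimal among the βᵗ over all upper bounds t of x and y (i.e., for every t ∈ 𝔸₁ with x ≤ t and y ≤ t, one has βᶻ ≤ βᵗ). -/

import Mathlib

open scoped BigOperators

/-- A generalized affine form: an `ℓ¹` family of noise coefficients `α` together with a
perturbation coefficient `β`. -/
structure AffineForm where
  α : ℕ → ℝ
  β : ℝ
  hsum : Summable fun i => |α i|

namespace AffineForm

/-- `ℓ¹` distance between the `α`-parts of two forms. -/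
noncomputable def distL (x y : AffineForm) : ℝ := ∑' i, |x.α i - y.α i|

/-- `ℓ¹` norm of the `α`-part. -/
noncomputable def normA (x : AffineForm) : ℝ := ∑' i, |x.α i|

/-- Total deviation of the noise part (indices `i ≥ 1`). -/
noncomputable def dev (x : AffineForm) : ℝ := ∑' i, |x.α (i + 1)|

/-- The perturbation order: `x ≤ y` iff `‖αˣ - αʸ‖₁ ≤ βʸ - βˣ`. -/
def le (x y : AffineForm) : Prop := distL x y ≤ y.β - x.β

/-- Lower bound of the concretization. -/
noncomputable def lo (x : AffineForm) : ℝ := x.α 0 - dev x - x.β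

/-- Upper bound of the concretization. -/
noncomputable def hi (x : AffineForm) : ℝ := x.α 0 + dev x + x.β

/-- The concretization interval. -/
noncomputable def γ (x : AffineForm) : Set ℝ := Set.Icc (lo x) (hi x)

/-- `z` is a minimal upper bound of `x` and `y` for the perturbation order. -/
def IsMub (x y z : AffineForm) : Prop :=
  x.le z ∧ y.le z ∧ ∀ w, x.le w → y.le w → w.le z → w = z

theorem summable_abs_sub (x y : AffineForm) : Summable fun i => |x.α i - y.α i| :=
  (x.hsum.of_abs.sub y.hsum.of_abs).abs

theorem distL_nonneg (x y : AffineForm) : 0 ≤ distL x y :=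
  tsum_nonneg fun _ => abs_nonneg _

theorem distL_comm (x y : AffineForm) : distL x y = distL y x :=
  tsum_congr fun _ => abs_sub_comm _ _

theorem distL_triangle (x y z : AffineForm) : distL x z ≤ distL x y + distL y z := by
  unfold distL
  rw [← (summable_abs_sub x y).tsum_add (summable_abs_sub y z)]
  exact (summable_abs_sub x z).tsum_le_tsum (fun i => abs_sub_le _ _ _)
    ((summable_abs_sub x y).add (summable_abs_sub y z))

theorem distL_add_eq {x p y : AffineForm}
    (h : ∀ i, |x.α i - p.α i| + |p.α i - y.α i| = |x.α i - y.α i|) :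
    distL x p + distL p y = distL x y := by
  unfold distL
  rw [← (summable_abs_sub x p).tsum_add (summable_abs_sub p y)]
  exact tsum_congr h

theorem α_eq_of_distL_nonpos {x y : AffineForm} (h : distL x y ≤ 0) : x.α = y.α := by
  funext i
  have hi : |x.α i - y.α i| ≤ distL x y :=
    (summable_abs_sub x y).le_tsum i fun _ _ => abs_nonneg _
  exact sub_eq_zero.mp (abs_nonpos_iff.mp (hi.trans h))

/-- The coordinatewise median of three forms. -/
noncomputable def median (x y z : AffineForm) : AffineForm where
  α i := max (min (x.α i) (y.α i)) (min (max (x.α i) (y.α i)) (z.α i))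
  β := 0
  hsum := by
    refine Summable.of_nonneg_of_le (fun _ => abs_nonneg _) (fun i => ?_)
      ((x.hsum.add y.hsum).add z.hsum)
    grind

theorem distL_median_xy (x y z : AffineForm) :
    distL x (median x y z) + distL (median x y z) y = distL x y := by
  refine distL_add_eq fun i => ?_
  simp only [median]
  grind

theorem distL_median_xz (x y z : AffineForm) :
    distL x (median x y z) + distL (median x y z) z = distL x z := by
  refine distL_add_eq fun i => ?_
  simp only [median]
  grind

theorem distL_median_yz (x y z : AffineForm) :
    distL y (median x y z) + distL (median x y z) z = distL y z := by
  refine distL_add_eq fun i => ?_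
  simp only [median]
  grind

/-- The point at parameter `s` on the segment from `p` to `x`. -/
noncomputable def segmentPoint (p x : AffineForm) (s : ℝ) : AffineForm where
  α i := p.α i + s * (x.α i - p.α i)
  β := 0
  hsum := (p.hsum.of_abs.add ((x.hsum.of_abs.sub p.hsum.of_abs).mul_left s)).abs

theorem distL_segmentPoint_left (p x : AffineForm) {s : ℝ} (hs : 0 ≤ s) :
    distL p (segmentPoint p x s) = s * distL x p := by
  unfold distL
  rw [← tsum_mul_left]
  refine tsum_congr fun i => ?_
  rw [abs_sub_comm]
  conv_rhs => rw [← abs_of_nonneg hs, ← abs_mul]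
  congr 1
  simp only [segmentPoint]
  ring

theorem distL_segmentPoint_right (p x : AffineForm) {s : ℝ} (hs : s ≤ 1) :
    distL x (segmentPoint p x s) = (1 - s) * distL x p := by
  have h : 0 ≤ 1 - s := sub_nonneg.mpr hs
  unfold distL
  rw [← tsum_mul_left]
  refine tsum_congr fun i => ?_
  conv_rhs => rw [← abs_of_nonneg h, ← abs_mul]
  congr 1
  simp only [segmentPoint]
  ring

/-- A point at distance more than `r` from `x` can be moved towards `x` onto the sphere of
radius `r`. -/
theorem exists_distL_eq_of_lt {p x : AffineForm} {r : ℝ} (hr : 0 ≤ r) (h : r < distL x p) :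
    ∃ q, distL x q = r ∧ distL p q = distL x p - r := by
  have hpos : 0 < distL x p := hr.trans_lt h
  have hs0 : 0 ≤ (distL x p - r) / distL x p := div_nonneg (by linarith) hpos.le
  have hs1 : (distL x p - r) / distL x p ≤ 1 := (div_le_one hpos).mpr (by linarith)
  refine ⟨segmentPoint p x ((distL x p - r) / distL x p), ?_, ?_⟩
  · rw [distL_segmentPoint_right p x hs1]
    field_simp
    ring
  · rw [distL_segmentPoint_left p x hs0]
    field_simp

/-- Three balls for the `ℓ¹` distance whose radii satisfy the pairwise intersection condition
have a common point. -/
theorem exists_mem_three_balls {x y z : AffineForm} {a b c : ℝ}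
    (ha : 0 ≤ a) (hb : 0 ≤ b) (hc : 0 ≤ c) (hxy : distL x y ≤ a + b)
    (hxz : distL x z ≤ a + c) (hyz : distL y z ≤ b + c) :
    ∃ w, distL x w ≤ a ∧ distL y w ≤ b ∧ distL z w ≤ c := by
  have h₁ := distL_median_xy x y z
  have h₂ := distL_median_xz x y z
  have h₃ := distL_median_yz x y z
  generalize median x y z = p at h₁ h₂ h₃
  rw [distL_comm p y] at h₁
  rw [distL_comm p z] at h₂ h₃
  have triangle (q : AffineForm) := And.intro (distL_triangle x p q)
    (And.intro (distL_triangle y p q) (distL_triangle z p q))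
  rcases lt_or_ge a (distL x p) with hx | hx
  · obtain ⟨q, hq, hpq⟩ := exists_distL_eq_of_lt ha hx
    obtain ⟨-, hy, hz⟩ := triangle q
    exact ⟨q, by linarith, by linarith, by linarith⟩
  rcases lt_or_ge b (distL y p) with hy | hy
  · obtain ⟨q, hq, hpq⟩ := exists_distL_eq_of_lt hb hy
    obtain ⟨hx, -, hz⟩ := triangle q
    exact ⟨q, by linarith, by linarith, by linarith⟩
  rcases lt_or_ge c (distL z p) with hz | hz
  · obtain ⟨q, hq, hpq⟩ := exists_distL_eq_of_lt hc hz
    obtain ⟨hx, hy, -⟩ := triangle q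
    exact ⟨q, by linarith, by linarith, by linarith⟩
  exact ⟨p, hx, hy, hz⟩

/-- The least `β` coefficient of an upper bound of `x` and `y`. -/
noncomputable def minBeta (x y : AffineForm) : ℝ :=
  max (max x.β y.β) ((x.β + y.β + distL x y) / 2)

theorem minBeta_le {x y t : AffineForm} (hx : x.le t) (hy : y.le t) : minBeta x y ≤ t.β := by
  unfold le at hx hy
  have h := distL_triangle x t y
  rw [distL_comm t y] at h
  have hx₀ := distL_nonneg x t
  have hy₀ := distL_nonneg y t
  exact max_le (max_le (by linarith) (by linarith)) (by linarith)

/-- Every upper bound of `x` and `y` dominates an upper bound with the least possible `β`. -/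
theorem exists_le_of_upper_bound {x y z : AffineForm} (hx : x.le z) (hy : y.le z) :
    ∃ w, x.le w ∧ y.le w ∧ w.le z ∧ w.β = minBeta x y := by
  have hz := minBeta_le hx hy
  have h₁ : x.β ≤ minBeta x y := (le_max_left _ _).trans (le_max_left _ _)
  have h₂ : y.β ≤ minBeta x y := (le_max_right _ _).trans (le_max_left _ _)
  have h₃ : (x.β + y.β + distL x y) / 2 ≤ minBeta x y := le_max_right _ _
  unfold le at hx hy
  obtain ⟨w, hxw, hyw, hzw⟩ := exists_mem_three_balls (x := x) (y := y) (z := z)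
    (sub_nonneg.mpr h₁) (sub_nonneg.mpr h₂) (sub_nonneg.mpr hz)
    (by linarith) (by linarith) (by linarith)
  rw [distL_comm] at hzw
  exact ⟨⟨w.α, minBeta x y, w.hsum⟩, hxw, hyw, hzw, rfl⟩

/-- Characterization of minimal upper bounds: `z` is a mub of `x` and `y` iff it is an
upper bound whose `β` coefficient is minimal among all upper bounds. -/
theorem isMub_iff_beta_minimal (x y z : AffineForm) :
    IsMub x y z ↔
      x.le z ∧ y.le z ∧ ∀ t, x.le t → y.le t → z.β ≤ t.β := by
  constructor
  · rintro ⟨hx, hy, hmin⟩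
    refine ⟨hx, hy, fun t hxt hyt => ?_⟩
    obtain ⟨w, hxw, hyw, hwz, hβ⟩ := exists_le_of_upper_bound hx hy
    rw [← hmin w hxw hyw hwz, hβ]
    exact minBeta_le hxt hyt
  · rintro ⟨hx, hy, hmin⟩
    refine ⟨hx, hy, fun w hxw hyw hwz => ?_⟩
    have hβ := hmin w hxw hyw
    unfold le at hwz
    have h₀ := distL_nonneg w z
    have hα : w.α = z.α := α_eq_of_distL_nonpos (by linarith)
    have hβ' : w.β = z.β := by linarith
    cases w
    cases z
    simp_all

end AffineForm
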